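/- arXiv:2503.09522 — 3 statements merged into one kernel-verified Lean document; each statement's English description precedes it below -/
import Mathlib

section
/- Fix d > 1, r > 1. Suppose c₁ < c₂ and 0 < κ₁ ≤ κ₂ satisfy κ₁² - c₁κ₁ + 1 < 0, dκ₁² - c₁κ₁ - r < 0, dκ₂² - c₂κ₂ + r < 0, dκ₂² - c₂κ₂ + r + κ₁(c₂ - c₁) < 0, and let ε > 0 satisfy dκ₁² - c₁κ₁ - r + 2rε < 0. Then there exist η > 0, α > 0 and a C¹ function φ : ℝ × ℝ → (-∞, 0] such that for all α₁, α₂ ∈ (0, α) and every function ū : ℝ × ℝ → ℝ² satisfying (i) 0 ≤ ū₁(t,x) ≤ 2 and 0 ≤ ū₂(t,x) ≤ 2 for all (t,x), (ii) ū₁(t,x) ≥ 1 and ū₂(t,x) ≥ 1 whenever x - c₁t ≤ 1, and (iii) ū₁(t,x) ≥ 1 - ε whenever x - c₁t ≥ 1 and x - c₂t ≤ 1, both diagonal entries of the 2×2 matrix A₀(t,x) := Jg(ū(t,x)) - ∂ₜφ(t,x)·I + (∂ₓφ(t,x))² D are ≤ -η for every t > 0 and x ∈ ℝ. -/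
/-- The diffusion matrix D = diag(d, 1). -/
noncomputable def Dmat (d : ℝ) : Matrix (Fin 2) (Fin 2) ℝ := !![d, 0; 0, 1]

/-- The Jacobian matrix of the reaction term g. -/
noncomputable def Jg (r α₁ α₂ : ℝ) (u : Fin 2 → ℝ) : Matrix (Fin 2) (Fin 2) ℝ :=
  !![r * (1 - 2 * u 0) + α₁ * u 1, α₁ * u 0;
     α₂ * u 1, 1 - 2 * u 1 + α₂ * u 0]

/-- The matrix A₀(t,x) = Jg(ū(t,x)) - ∂ₜφ(t,x)·I + (∂ₓφ(t,x))²·D. -/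
noncomputable def A₀ (d r α₁ α₂ : ℝ) (ub : ℝ → ℝ → Fin 2 → ℝ) (φ : ℝ → ℝ → ℝ)
    (t x : ℝ) : Matrix (Fin 2) (Fin 2) ℝ :=
  Jg r α₁ α₂ (ub t x) - (deriv (fun s => φ s x) t) • (1 : Matrix (Fin 2) (Fin 2) ℝ)
    + ((deriv (fun y => φ t y) x) ^ 2) • Dmat d

/-- The clamp function, derivative of the smoothed positive part. -/
noncomputable def clampFun (y : ℝ) : ℝ := max 0 (min y 1)

/-- Smoothed positive part. -/
noncomputable def HFun (y : ℝ) : ℝ := ∫ s in (0:ℝ)..y, clampFun s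

lemma clampFun_cont : Continuous clampFun := by
  unfold clampFun; fun_prop

lemma HFun_hasDeriv (y : ℝ) : HasDerivAt HFun (clampFun y) y :=
  (clampFun_cont.integral_hasStrictDerivAt 0 y).hasDerivAt

lemma HFun_contDiff : ContDiff ℝ 1 HFun := by
  rw [contDiff_one_iff_deriv]
  refine ⟨fun y => (HFun_hasDeriv y).differentiableAt, ?_⟩
  have : deriv HFun = clampFun := funext fun y => (HFun_hasDeriv y).deriv
  rw [this]; exact clampFun_cont

lemma clampFun_nonneg (y : ℝ) : 0 ≤ clampFun y := le_max_left _ _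

lemma clampFun_le_one (y : ℝ) : clampFun y ≤ 1 :=
  max_le zero_le_one (min_le_right _ _)

lemma clampFun_mono : Monotone clampFun := fun _ _ h =>
  max_le_max le_rfl (min_le_min h le_rfl)

lemma clampFun_eq_one {y : ℝ} (h : 1 ≤ y) : clampFun y = 1 := by
  simp [clampFun, h]

lemma HFun_nonneg (y : ℝ) : 0 ≤ HFun y := by
  rcases le_total 0 y with h | h
  · exact intervalIntegral.integral_nonneg h fun s _ => clampFun_nonneg s
  · have : HFun y = ∫ s in (0:ℝ)..y, (0:ℝ) := by
      apply intervalIntegral.integral_congr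
      intro s hs
      rw [Set.uIcc_of_ge h] at hs
      exact max_eq_left ((min_le_left _ _).trans hs.2)
    rw [this]; simp

lemma convex_aux (e k l c c' p q : ℝ) (he : 0 ≤ e) (hq : 0 ≤ q) (hpq : q ≤ p) (hp : p ≤ 1) :
    e * (k * p + (l - k) * q) ^ 2 - (k * c * p + (l - k) * c' * q) ≤
      (p - q) * (e * k ^ 2 - c * k) + q * (e * l ^ 2 - c' * l + k * (c' - c)) := by
  have h : (k * p + (l - k) * q) ^ 2 ≤ (p - q) * k ^ 2 + q * l ^ 2 := by
    have h1 : 0 ≤ (1 - p) * ((p - q) * k ^ 2 + q * l ^ 2) := by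
      have := sub_nonneg.2 hp
      have := sub_nonneg.2 hpq
      positivity
    have h2 : 0 ≤ (p - q) * q * (k - l) ^ 2 := by
      have := sub_nonneg.2 hpq
      positivity
    linarith
  have := mul_le_mul_of_nonneg_left h he
  linarith

/-- existence of a C¹ weight exponent φ ≤ 0 making the diagonal entries
of A₀ uniformly negative for all small coupling coefficients and all admissible profiles ū. -/
theorem stmt2 (d r c₁ c₂ κ₁ κ₂ ε : ℝ) (hd : 1 < d) (hr : 1 < r)
    (hc : c₁ < c₂) (hκ₁ : 0 < κ₁) (hκ₁₂ : κ₁ ≤ κ₂)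
    (h1 : κ₁ ^ 2 - c₁ * κ₁ + 1 < 0) (h2 : d * κ₁ ^ 2 - c₁ * κ₁ - r < 0)
    (h3 : d * κ₂ ^ 2 - c₂ * κ₂ + r < 0)
    (h4 : d * κ₂ ^ 2 - c₂ * κ₂ + r + κ₁ * (c₂ - c₁) < 0)
    (hε : 0 < ε) (h5 : d * κ₁ ^ 2 - c₁ * κ₁ - r + 2 * r * ε < 0) :
    ∃ η > 0, ∃ α > 0, ∃ φ : ℝ → ℝ → ℝ,
      ContDiff ℝ 1 (fun z : ℝ × ℝ => φ z.1 z.2) ∧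
      (∀ t x, φ t x ≤ 0) ∧
      ∀ α₁ ∈ Set.Ioo (0 : ℝ) α, ∀ α₂ ∈ Set.Ioo (0 : ℝ) α,
      ∀ ub : ℝ → ℝ → Fin 2 → ℝ,
        (∀ t x, 0 ≤ ub t x 0 ∧ ub t x 0 ≤ 2 ∧ 0 ≤ ub t x 1 ∧ ub t x 1 ≤ 2) →
        (∀ t x, x - c₁ * t ≤ 1 → 1 ≤ ub t x 0 ∧ 1 ≤ ub t x 1) →
        (∀ t x, 1 ≤ x - c₁ * t → x - c₂ * t ≤ 1 → 1 - ε ≤ ub t x 0) →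
        ∀ t > (0 : ℝ), ∀ x : ℝ,
          A₀ d r α₁ α₂ ub φ t x 0 0 ≤ -η ∧ A₀ d r α₁ α₂ ub φ t x 1 1 ≤ -η := by
  obtain ⟨δ, hδ, hδ1, hδa, hδb, hδc⟩ : ∃ δ > 0, δ ≤ 1 ∧ κ₁ ^ 2 - c₁ * κ₁ + 1 ≤ -δ ∧
      d * κ₂ ^ 2 - c₂ * κ₂ + r + κ₁ * (c₂ - c₁) ≤ -δ ∧
      d * κ₁ ^ 2 - c₁ * κ₁ - r + 2 * r * ε ≤ -δ := by
    refine ⟨min 1 (min (-(κ₁ ^ 2 - c₁ * κ₁ + 1))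
      (min (-(d * κ₂ ^ 2 - c₂ * κ₂ + r + κ₁ * (c₂ - c₁)))
        (-(d * κ₁ ^ 2 - c₁ * κ₁ - r + 2 * r * ε)))), ?_, min_le_left _ _, ?_, ?_, ?_⟩
    · simp only [gt_iff_lt, lt_min_iff]
      refine ⟨one_pos, ?_, ?_, ?_⟩ <;> linarith
    · exact le_neg_of_le_neg ((min_le_right _ _).trans (min_le_left _ _))
    · exact le_neg_of_le_neg ((min_le_right _ _).trans ((min_le_right _ _).trans (min_le_left _ _)))
    · exact le_neg_of_le_neg ((min_le_right _ _).trans ((min_le_right _ _).trans (min_le_right _ _)))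
  refine ⟨δ / 2, by positivity, δ / 4, by positivity,
    fun t x => -(κ₁ * HFun (x - c₁ * t) + (κ₂ - κ₁) * HFun (x - c₂ * t)), ?_, ?_, ?_⟩
  · have h := HFun_contDiff
    have e1 : ContDiff ℝ 1 (fun z : ℝ × ℝ => HFun (z.2 - c₁ * z.1)) :=
      h.comp (by fun_prop)
    have e2 : ContDiff ℝ 1 (fun z : ℝ × ℝ => HFun (z.2 - c₂ * z.1)) :=
      h.comp (by fun_prop)
    exact ((contDiff_const.mul e1).add (contDiff_const.mul e2)).neg
  · intro t x
    have a1 := mul_nonneg hκ₁.le (HFun_nonneg (x - c₁ * t))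
    have a2 := mul_nonneg (sub_nonneg.2 hκ₁₂) (HFun_nonneg (x - c₂ * t))
    linarith
  intro α₁ hα₁ α₂ hα₂ ub hb hb1 hb2 t ht x
  have hdt : ∀ c, HasDerivAt (fun s => HFun (x - c * s)) (clampFun (x - c * t) * (-(c * 1))) t :=
    fun c => HasDerivAt.comp (h₂ := HFun) (h := fun s => x - c * s) t (HFun_hasDeriv (x - c * t))
      (((hasDerivAt_id t).const_mul c).const_sub x)
  have hdx : ∀ c, HasDerivAt (fun y => HFun (y - c * t)) (clampFun (x - c * t) * 1) x :=
    fun c => HasDerivAt.comp (h₂ := HFun) (h := fun y => y - c * t) x (HFun_hasDeriv (x - c * t))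
      ((hasDerivAt_id x).sub_const (c * t))
  have Dt := ((((hdt c₁).const_mul κ₁).add ((hdt c₂).const_mul (κ₂ - κ₁))).neg).deriv
  have Dx := ((((hdx c₁).const_mul κ₁).add ((hdx c₂).const_mul (κ₂ - κ₁))).neg).deriv
  have hlt : x - c₂ * t ≤ x - c₁ * t := by nlinarith
  have hqp := clampFun_mono hlt
  have hp1 := clampFun_le_one (x - c₁ * t)
  have hq0 := clampFun_nonneg (x - c₂ * t)
  have hpe : 1 ≤ x - c₁ * t → clampFun (x - c₁ * t) = 1 := clampFun_eq_one
  have hqe : 1 ≤ x - c₂ * t → clampFun (x - c₂ * t) = 1 := clampFun_eq_one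
  obtain ⟨b1, b2, b3, b4⟩ := hb t x
  have hb1 := hb1 t x
  have hb2 := hb2 t x
  have E : ∀ i, A₀ d r α₁ α₂ ub
      (fun t x => -(κ₁ * HFun (x - c₁ * t) + (κ₂ - κ₁) * HFun (x - c₂ * t))) t x i i =
      Jg r α₁ α₂ (ub t x) i i - -(κ₁ * (clampFun (x - c₁ * t) * (-(c₁ * 1)))
        + (κ₂ - κ₁) * (clampFun (x - c₂ * t) * (-(c₂ * 1)))) +
      (-(κ₁ * (clampFun (x - c₁ * t) * 1)
        + (κ₂ - κ₁) * (clampFun (x - c₂ * t) * 1))) ^ 2 * Dmat d i i := by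
    intro i
    rw [← Dt, ← Dx]
    simp only [A₀, Matrix.add_apply, Matrix.sub_apply, Matrix.smul_apply, Matrix.one_apply_eq,
      smul_eq_mul, mul_one]
    rfl
  rw [E, E]
  simp only [Jg, Dmat, Matrix.of_apply, Matrix.cons_val', Matrix.cons_val_zero,
    Matrix.cons_val_one, Matrix.cons_val_fin_one]
  clear E Dt Dx hdt hdx
  generalize clampFun (x - c₁ * t) = p at *
  generalize clampFun (x - c₂ * t) = q at *
  generalize ub t x 0 = u at *
  generalize ub t x 1 = v at *
  have C1 := convex_aux d κ₁ κ₂ c₁ c₂ p q (by linarith) hq0 hqp hp1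
  have C2 := convex_aux 1 κ₁ κ₂ c₁ c₂ p q (by linarith) hq0 hqp hp1
  have P1 : α₁ * v ≤ δ / 2 := by nlinarith [hα₁.1, hα₁.2]
  have P2 : α₂ * u ≤ δ / 2 := by nlinarith [hα₂.1, hα₂.2]
  have hrε : 0 < r * ε := by positivity
  have hV1 : d * κ₁ ^ 2 - c₁ * κ₁ ≤ r - 2 * (r * ε) - δ := by linarith
  have hV2 : d * κ₂ ^ 2 - c₂ * κ₂ + κ₁ * (c₂ - c₁) ≤ - r - δ := by linarith
  have hW1 : 1 * κ₁ ^ 2 - c₁ * κ₁ ≤ -1 - δ := by linarith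
  have hW2 : 1 * κ₂ ^ 2 - c₂ * κ₂ + κ₁ * (c₂ - c₁) ≤ -1 - δ := by
    nlinarith [sq_nonneg κ₂]
  have ha : 0 ≤ p - q := by linarith
  have M1 := mul_le_mul_of_nonneg_left hV1 ha
  have M2 := mul_le_mul_of_nonneg_left hV2 hq0
  have N1 := mul_le_mul_of_nonneg_left hW1 ha
  have N2 := mul_le_mul_of_nonneg_left hW2 hq0
  have hru : 0 ≤ r * u := by positivity
  suffices S : r * (1 - 2 * u) + ((p - q) * (r - 2 * (r * ε) - δ) + q * (- r - δ)) ≤ -δ ∧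
      1 - 2 * v + ((p - q) * (-1 - δ) + q * (-1 - δ)) ≤ -δ by
    constructor
    · linarith [S.1]
    · linarith [S.2]
  clear C1 C2 M1 M2 N1 N2
  rcases le_total (x - c₁ * t) 1 with hx | hx
  · obtain ⟨hu, hv⟩ := hb1 hx
    have k1 : 0 ≤ r * (u - 1) := mul_nonneg (by linarith) (by linarith)
    have k2 : 0 ≤ (1 - (p - q)) * (r - δ) := mul_nonneg (by linarith) (by linarith)
    have k3 : 0 ≤ (p - q) * (r * ε) := by positivity
    have k4 : 0 ≤ q * (r + δ) := by positivity
    have k5 : 0 ≤ (p - q) * (1 + δ) := by positivity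
    have k6 : 0 ≤ q * (1 + δ) := by positivity
    constructor <;> linarith
  · have hp := hpe hx
    subst hp
    refine ⟨?_, by linarith⟩
    rcases le_total (x - c₂ * t) 1 with hy | hy
    · have hu := hb2 hx hy
      have k1 : 0 ≤ (1 - q) * (r * (u - (1 - ε))) :=
        mul_nonneg ha (mul_nonneg (by linarith) (by linarith))
      have k2 : 0 ≤ q * (r * u) := by positivity
      linarith
    · have hq := hqe hy
      subst hq
      linarith
end

section
/- Let d > 0, r > 0 and c > 2√(dr). Let p : ℝ → ℝ be nonincreasing with 0 ≤ p(y) ≤ 1 for all y and p(y) ≥ 3/4 for all y ≤ 1. Then there exist η > 0 and a C^∞ function φ : ℝ × ℝ → ℝ with φ ≤ 0 such that for all (t,x) ∈ ℝ × ℝ: r(1 - 2p(x - ct)) - ∂ₜφ(t,x) + d (∂ₓφ(t,x))² ≤ -η. -/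
/-- existence of a weight φ making the zeroth-order coefficient of the
weighted linearization of the KPP equation about a front profile uniformly negative. -/
theorem stmt5 (d r c : ℝ) (hd : 0 < d) (hr : 0 < r)
    (hc : 2 * Real.sqrt (d * r) < c)
    (p : ℝ → ℝ) (hmono : Antitone p)
    (hp : ∀ y, 0 ≤ p y ∧ p y ≤ 1) (hp34 : ∀ y ≤ (1 : ℝ), 3 / 4 ≤ p y) :
    ∃ η > 0, ∃ φ : ℝ → ℝ → ℝ,
      ContDiff ℝ (⊤ : ℕ∞) (fun z : ℝ × ℝ => φ z.1 z.2) ∧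
      (∀ t x, φ t x ≤ 0) ∧
      (∀ t x : ℝ,
        r * (1 - 2 * p (x - c * t)) - deriv (fun s => φ s x) t
          + d * (deriv (fun y => φ t y) x) ^ 2 ≤ -η) := by
  have hs0 : 0 ≤ Real.sqrt (d * r) := Real.sqrt_nonneg _
  have hsq : Real.sqrt (d * r) ^ 2 = d * r := Real.sq_sqrt (by positivity)
  have hc0 : 0 < c := by linarith
  have hc2 : 4 * (d * r) < c ^ 2 := by nlinarith
  obtain ⟨k, hk⟩ : ∃ k, k = c / (2 * d) := ⟨_, rfl⟩
  have hk0 : 0 < k := by rw [hk]; positivity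
  have hck : c = 2 * d * k := by rw [hk]; field_simp
  obtain ⟨M, hM⟩ : ∃ M, M = d * k ^ 2 := ⟨_, rfl⟩
  have hMr : r < M := by
    rw [hM]
    rw [hck] at hc2
    by_contra h
    push Not at h
    nlinarith
  have hM0 : 0 < M := hr.trans hMr
  obtain ⟨A, hA⟩ : ∃ A, A = 2 * M / (M - r) := ⟨_, rfl⟩
  have hMr' : 0 < M - r := by linarith
  have hA0 : 0 < A := by rw [hA]; positivity
  have hAM : A * (M - r) = 2 * M := by rw [hA]; field_simp
  have hder : ∀ y : ℝ, HasDerivAt (fun y => -k * Real.log (1 + A * Real.exp y))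
      (-k * (A * Real.exp y / (1 + A * Real.exp y))) y := by
    intro y
    have hpos : 0 < 1 + A * Real.exp y := by positivity
    exact (((((Real.hasDerivAt_exp y).const_mul A).const_add 1).log hpos.ne').const_mul (-k))
  refine ⟨min (r / 2) ((M - r) / 2), by positivity,
    fun t x => -k * Real.log (1 + A * Real.exp (x - c * t)), ?_, ?_, ?_⟩
  · apply ContDiff.mul contDiff_const
    apply ContDiff.log
    · fun_prop
    · intro z
      positivity
  · intro t x
    have : 0 ≤ Real.log (1 + A * Real.exp (x - c * t)) := by
      apply Real.log_nonneg
      have : 0 < A * Real.exp (x - c * t) := by positivity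
      linarith
    nlinarith
  · intro t x
    have h1 : HasDerivAt (fun s : ℝ => x - c * s) (-c) t := by
      simpa using ((hasDerivAt_id t).const_mul c).const_sub x
    have h2 : HasDerivAt (fun y : ℝ => y - c * t) 1 x := (hasDerivAt_id x).sub_const _
    have e1 := ((hder (x - c * t)).comp t h1).deriv
    have e2 := ((hder (x - c * t)).comp x h2).deriv
    simp only [Function.comp_def] at e1 e2
    rw [e1, e2]
    generalize x - c * t = y
    obtain ⟨s, hs⟩ : ∃ s, s = A * Real.exp y / (1 + A * Real.exp y) := ⟨_, rfl⟩
    rw [← hs]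
    have hE : 0 < A * Real.exp y := by positivity
    have hs0 : 0 ≤ s := by rw [hs]; positivity
    have hs1 : s ≤ 1 := by rw [hs, div_le_one (by positivity)]; linarith
    have key : r * (1 - 2 * p y) - -k * s * -c + d * (-k * s * 1) ^ 2
        = r * (1 - 2 * p y) - M * (1 - (1 - s) ^ 2) := by
      rw [hM, hck]; ring
    rw [key]
    rcases le_total y 1 with hy | hy
    · have := hp34 y hy
      have h3 : 0 ≤ M * (1 - (1 - s) ^ 2) := by
        apply mul_nonneg hM0.le
        nlinarith
      have := min_le_left (r / 2) ((M - r) / 2)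
      nlinarith
    · have h4 := (hp y).1
      have h5 : A * (1 - s) ≤ 1 := by
        have : 1 ≤ Real.exp y := Real.one_le_exp (by linarith)
        have h6 : 1 - s = 1 / (1 + A * Real.exp y) := by rw [hs]; field_simp; ring
        rw [h6, mul_one_div, div_le_one (by positivity)]
        nlinarith
      have h7 : M * (1 - s) ≤ (M - r) / 2 := by
        have := mul_le_mul_of_nonneg_right h5 hMr'.le
        have h8 : A * (1 - s) * (M - r) = 2 * (M * (1 - s)) := by
          linear_combination (1 - s) * hAM
        linarith
      have h9 : M * (1 - s) ^ 2 ≤ M * (1 - s) := by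
        apply mul_le_mul_of_nonneg_left _ hM0.le
        nlinarith
      have := min_le_right (r / 2) ((M - r) / 2)
      nlinarith [mul_nonneg hr.le h4]
end

section
/- Let r > 0, α₁ > 0, α₂ > 0 with r - α₁α₂ > 0. Then g(e₁) = 0, and the 2×2 real matrix Jg(e₁) satisfies trace Jg(e₁) < 0 and det Jg(e₁) > 0; consequently every eigenvalue λ ∈ ℂ of Jg(e₁) has Re λ < 0. -/
/-- The reaction term g. -/
noncomputable def g (r α₁ α₂ : ℝ) (u : Fin 2 → ℝ) : Fin 2 → ℝ :=
  ![r * u 0 * (1 - u 0) + α₁ * u 0 * u 1, u 1 * (1 - u 1) + α₂ * u 0 * u 1]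

/-- The cohabitation equilibrium e₁. -/
noncomputable def e₁ (r α₁ α₂ : ℝ) : Fin 2 → ℝ :=
  ![(r + α₁) / (r - α₁ * α₂), r * (1 + α₂) / (r - α₁ * α₂)]

/-- spectral stability of the equilibrium e₁. -/
theorem stmt8 (r α₁ α₂ : ℝ) (hr : 0 < r) (hα₁ : 0 < α₁) (hα₂ : 0 < α₂)
    (hst : 0 < r - α₁ * α₂) :
    g r α₁ α₂ (e₁ r α₁ α₂) = 0 ∧
    (Jg r α₁ α₂ (e₁ r α₁ α₂)).trace < 0 ∧
    0 < (Jg r α₁ α₂ (e₁ r α₁ α₂)).det ∧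
    ∀ z : ℂ, ((Jg r α₁ α₂ (e₁ r α₁ α₂)).map Complex.ofReal).charpoly.IsRoot z →
      z.re < 0 := by
  obtain ⟨a, ha⟩ : ∃ a, a = (r + α₁) / (r - α₁ * α₂) := ⟨_, rfl⟩
  obtain ⟨b, hb⟩ : ∃ b, b = r * (1 + α₂) / (r - α₁ * α₂) := ⟨_, rfl⟩
  have ha0 : 0 < a := by rw [ha]; positivity
  have hb0 : 0 < b := by rw [hb]; positivity
  have hne : r - α₁ * α₂ ≠ 0 := hst.ne'
  have h1 : r * (1 - a) + α₁ * b = 0 := by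
    rw [ha, hb]; field_simp; ring
  have h2 : 1 - b + α₂ * a = 0 := by
    have ha2 := (eq_div_iff hne).mp ha
    have hb2 := (eq_div_iff hne).mp hb
    have h3 : (1 - b + α₂ * a) * (r - α₁ * α₂) = 0 := by
      linear_combination α₂ * ha2 - hb2
    exact (mul_eq_zero.mp h3).resolve_right hne
  have he : e₁ r α₁ α₂ = ![a, b] := by rw [ha, hb]; rfl
  have hJ : Jg r α₁ α₂ (e₁ r α₁ α₂) = !![-(r * a), α₁ * a; α₂ * b, -b] := by
    rw [he]
    have e1 : r * (1 - 2 * a) + α₁ * b = -(r * a) := by linarith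
    have e2 : 1 - 2 * b + α₂ * a = -b := by linarith
    simp [Jg, e1, e2]
  have hra : 0 < r * a := mul_pos hr ha0
  have hD : 0 < a * b * (r - α₁ * α₂) := by positivity
  rw [hJ]
  refine ⟨?_, ?_, ?_, ?_⟩
  · rw [he]
    ext i
    fin_cases i
    · simp [g]; linear_combination a * h1
    · simp [g]; linear_combination b * h2
  · simp [Matrix.trace_fin_two]; linarith
  · rw [Matrix.det_fin_two_of]; linarith
  · intro z hz
    rw [Polynomial.IsRoot.def, Matrix.charpoly_fin_two] at hz
    simp [Matrix.trace_fin_two, Matrix.det_fin_two] at hz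
    have hre := congrArg Complex.re hz
    have him := congrArg Complex.im hz
    simp [pow_two] at hre him
    by_contra! hx
    have hy : z.im * (2 * z.re + r * a + b) = 0 := by linarith
    have hy0 : z.im = 0 := by
      rcases mul_eq_zero.mp hy with h | h
      · exact h
      · linarith
    rw [hy0] at hre
    nlinarith [mul_nonneg hx hx, mul_nonneg hra.le hx, mul_nonneg hb0.le hx]
end
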